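/- arXiv:2202.05687 — 6 statements merged into one kernel-verified Lean document; each statement's English description precedes it below -/
import Mathlib

section
/- Let d be a positive integer, let g be a nonzero vector in the Euclidean space ℝ^d, and let ε > 0 and γ > 0 be real numbers. If r_1, …, r_k are pairwise orthogonal nonzero vectors in ℝ^d satisfying ‖r_i‖₂ ≤ ε and ⟨g, r_i⟩ ≥ γ for every 1 ≤ i ≤ k, then k ≤ min(d, ε²‖g‖₂²/γ²). -/
open scoped RealInnerProductSpace

/-- Single-model ℓ2 adversarial-dimension bound (upper-bound direction, n = 1 case of
Lemma 3.1): pairwise orthogonal nonzero perturbations of norm at most ε whose inner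
product with the nonzero gradient g is at least γ number at most min(d, ε²‖g‖²/γ²). -/
theorem stmt_0 (d k : ℕ) (hd : 0 < d)
    (g : EuclideanSpace ℝ (Fin d)) (hg : g ≠ 0)
    (ε γ : ℝ) (hε : 0 < ε) (hγ : 0 < γ)
    (r : Fin k → EuclideanSpace ℝ (Fin d))
    (hr0 : ∀ i, r i ≠ 0)
    (horth : ∀ i j, i ≠ j → ⟪r i, r j⟫ = 0)
    (hnorm : ∀ i, ‖r i‖ ≤ ε)
    (hip : ∀ i, γ ≤ ⟪g, r i⟫) :
    (k : ℝ) ≤ min (d : ℝ) (ε ^ 2 * ‖g‖ ^ 2 / γ ^ 2) := by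
  have hpw : Pairwise fun i j => ⟪r i, r j⟫ = 0 := fun i j hij => horth i j hij
  refine le_min ?_ ?_
  · have hcard :=
      (linearIndependent_of_ne_zero_of_inner_eq_zero (𝕜 := ℝ) hr0 hpw).fintype_card_le_finrank
    rw [Fintype.card_fin, finrank_euclideanSpace_fin] at hcard
    exact_mod_cast hcard
  · have hv : Orthonormal ℝ fun i => ‖r i‖⁻¹ • r i := by
      refine ⟨fun i => ?_, fun i j hij => ?_⟩
      · rw [norm_smul, norm_inv, norm_norm, inv_mul_cancel₀ (norm_ne_zero_iff.mpr (hr0 i))]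
      · simp only [real_inner_smul_left, real_inner_smul_right, hpw hij, mul_zero]
    have hterm : ∀ i, (γ / ε) ^ 2 ≤ ‖⟪‖r i‖⁻¹ • r i, g⟫‖ ^ 2 := by
      intro i
      have hpos : 0 < ‖r i‖ := norm_pos_iff.mpr (hr0 i)
      have hle : γ / ε ≤ ⟪‖r i‖⁻¹ • r i, g⟫ := by
        rw [real_inner_smul_left, real_inner_comm, inv_mul_eq_div]
        exact div_le_div₀ (hγ.le.trans (hip i)) (hip i) hpos (hnorm i)
      exact pow_le_pow_left₀ (by positivity) (hle.trans (Real.le_norm_self _)) 2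
    have hbessel : (k : ℝ) * (γ / ε) ^ 2 ≤ ‖g‖ ^ 2 := by
      calc (k : ℝ) * (γ / ε) ^ 2 = ∑ _i : Fin k, (γ / ε) ^ 2 := by simp
        _ ≤ ∑ i : Fin k, ‖⟪‖r i‖⁻¹ • r i, g⟫‖ ^ 2 := Finset.sum_le_sum fun i _ => hterm i
        _ ≤ ‖g‖ ^ 2 := hv.sum_inner_products_le g
    rw [div_pow, ← mul_div_assoc, div_le_iff₀ (by positivity)] at hbessel
    rw [le_div_iff₀ (by positivity)]
    linarith
end

section
/- Let d be a positive integer, let g be a nonzero vector in the Euclidean space ℝ^d, and let ε > 0 and γ > 0 be real numbers. For every natural number k with 1 ≤ k ≤ min(d, ⌊ε²‖g‖₂²/γ²⌋), there exist pairwise orthogonal vectors r_1, …, r_k in ℝ^d such that ‖r_i‖₂ ≤ ε and ⟨g, r_i⟩ ≥ γ for every 1 ≤ i ≤ k. -/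
open scoped RealInnerProductSpace

/-- If an orthonormal family of `k` vectors exists, then every vector `g` has the same inner product
`‖g‖ / √k` with all members of some orthonormal family of `k` vectors. -/
theorem Orthonormal.exists_orthonormal_inner_eq {E : Type*} [NormedAddCommGroup E]
    [InnerProductSpace ℝ E] {k : ℕ} (hk : 0 < k) {e : Fin k → E} (he : Orthonormal ℝ e) (g : E) :
    ∃ u : Fin k → E, Orthonormal ℝ u ∧ ∀ i, inner ℝ g (u i) = ‖g‖ / √k := by
  have hk' : (0 : ℝ) < k := by exact_mod_cast hk
  set c : ℝ := ‖g‖ / √k with hc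
  set v : E := ∑ i, c • e i with hv
  have hev (i : Fin k) : inner ℝ v (e i) = c := by
    rw [real_inner_comm]
    exact he.inner_right_fintype (fun _ => c) i
  have hnorm : ‖v‖ = ‖g‖ := by
    have hsq : ‖v‖ ^ 2 = ‖g‖ ^ 2 := by
      rw [← real_inner_self_eq_norm_sq]
      nth_rewrite 2 [hv]
      simp only [inner_sum, inner_smul_right, hev, Finset.sum_const, Finset.card_univ,
        Fintype.card_fin, nsmul_eq_mul, hc]
      rw [div_mul_div_comm, Real.mul_self_sqrt hk'.le]
      field_simp
    exact (sq_eq_sq₀ (norm_nonneg _) (norm_nonneg _)).mp hsq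
  let T := (Submodule.span ℝ {v - g})ᗮ.reflection
  have hT : T v = g := Submodule.reflection_sub hnorm
  refine ⟨fun i => T (e i), he.comp_linearIsometry T.toLinearIsometry, fun i => ?_⟩
  calc inner ℝ g (T (e i)) = inner ℝ (T v) (T (e i)) := by rw [hT]
    _ = c := by rw [T.inner_map_map, hev]

/-- Single-model ℓ2 adversarial-dimension bound, attainment direction (n = 1 case of
Lemma 3.1): for every 1 ≤ k ≤ min(d, ⌊ε²‖g‖²/γ²⌋) there exist k pairwise orthogonal
perturbations of norm at most ε whose inner product with g is at least γ. -/
theorem stmt_1 (d : ℕ) (hd : 0 < d)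
    (g : EuclideanSpace ℝ (Fin d)) (hg : g ≠ 0)
    (ε γ : ℝ) (hε : 0 < ε) (hγ : 0 < γ)
    (k : ℕ) (hk1 : 1 ≤ k) (hkd : k ≤ d)
    (hkfl : (k : ℤ) ≤ ⌊ε ^ 2 * ‖g‖ ^ 2 / γ ^ 2⌋) :
    ∃ r : Fin k → EuclideanSpace ℝ (Fin d),
      (∀ i j, i ≠ j → ⟪r i, r j⟫ = 0) ∧
      (∀ i, ‖r i‖ ≤ ε) ∧
      (∀ i, γ ≤ ⟪g, r i⟫) := by
  have he := (EuclideanSpace.basisFun (Fin d) ℝ).orthonormal.comp (Fin.castLE hkd)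
    (Fin.castLE_injective hkd)
  obtain ⟨u, hu, hgu⟩ := he.exists_orthonormal_inner_eq hk1 g
  have hk : (0 : ℝ) < k := by exact_mod_cast hk1
  have hbound : (k : ℝ) * γ ^ 2 ≤ ε ^ 2 * ‖g‖ ^ 2 := by
    rw [← le_div_iff₀ (by positivity)]
    exact_mod_cast Int.le_floor.mp hkfl
  refine ⟨fun i => ε • u i, fun i j hij => ?_, fun i => ?_, fun i => ?_⟩
  · simp [inner_smul_left, inner_smul_right, hu.inner_eq_zero hij]
  · simp [norm_smul, hu.norm_eq_one, abs_of_pos hε]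
  · rw [inner_smul_right, hgu, ← mul_div_assoc, le_div_iff₀ (Real.sqrt_pos.mpr hk)]
    refine (sq_le_sq₀ (by positivity) (by positivity)).mp ?_
    rw [mul_pow, mul_pow, Real.sq_sqrt hk.le]
    linarith
end

section
/- (Lemma 3.1, at-least-one voting, upper bound.) Let d, n be positive integers, let g_1, …, g_n be vectors in the Euclidean space ℝ^d that are pairwise orthogonal (⟨g_i, g_j⟩ = 0 for i ≠ j), and let γ_1, …, γ_n > 0 and ε > 0 be real numbers. If r_1, …, r_k are pairwise orthogonal nonzero vectors in ℝ^d satisfying ‖r_i‖₂ ≤ ε and ⟨g_j, r_i⟩ ≥ γ_j for all 1 ≤ i ≤ k and all 1 ≤ j ≤ n, then k ≤ min(d, ⌊ε² · (Σ_{j=1}^{n} ‖g_j‖₂²) / (Σ_{j=1}^{n} γ_j)²⌋). -/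
open scoped RealInnerProductSpace

theorem norm_sum_sq_of_pairwise_orthogonal {ι E : Type*} [Fintype ι] [NormedAddCommGroup E]
    [InnerProductSpace ℝ E] (v : ι → E) (hv : ∀ i j, i ≠ j → ⟪v i, v j⟫ = 0) :
    ‖∑ i, v i‖ ^ 2 = ∑ i, ‖v i‖ ^ 2 := by
  rw [← real_inner_self_eq_norm_sq, sum_inner]
  refine Finset.sum_congr rfl fun i _ => ?_
  rw [inner_sum, Finset.sum_eq_single i (fun j _ hj => hv i j hj.symm) (by simp),
    real_inner_self_eq_norm_sq]

/-- If `k` pairwise orthogonal vectors of norm at most `ε` all have inner product at least `c ≥ 0`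
with `x`, then `k * c ^ 2 ≤ ε ^ 2 * ‖x‖ ^ 2`. -/
theorem card_mul_sq_le_of_pairwise_orthogonal {ι E : Type*} [Fintype ι] [NormedAddCommGroup E]
    [InnerProductSpace ℝ E] (v : ι → E) (hv : ∀ i j, i ≠ j → ⟪v i, v j⟫ = 0) {ε c : ℝ}
    (hε : ∀ i, ‖v i‖ ≤ ε) (x : E) (hc : 0 ≤ c) (hx : ∀ i, c ≤ ⟪x, v i⟫) :
    (Fintype.card ι : ℝ) * c ^ 2 ≤ ε ^ 2 * ‖x‖ ^ 2 := by
  rcases isEmpty_or_nonempty ι with h | h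
  · simpa using mul_nonneg (sq_nonneg ε) (sq_nonneg ‖x‖)
  have hk : (0 : ℝ) < Fintype.card ι := by exact_mod_cast Fintype.card_pos
  have hinner : Fintype.card ι * c ≤ ⟪x, ∑ i, v i⟫ := by
    rw [inner_sum]
    simpa using Finset.sum_le_sum fun i (_ : i ∈ Finset.univ) => hx i
  have hnorm : ‖∑ i, v i‖ ^ 2 ≤ Fintype.card ι * ε ^ 2 := by
    rw [norm_sum_sq_of_pairwise_orthogonal v hv]
    simpa using Finset.sum_le_sum fun i (_ : i ∈ Finset.univ) =>
      pow_le_pow_left₀ (norm_nonneg (v i)) (hε i) 2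
  refine le_of_mul_le_mul_left ?_ hk
  calc (Fintype.card ι : ℝ) * (Fintype.card ι * c ^ 2) = (Fintype.card ι * c) ^ 2 := by ring
    _ ≤ (‖x‖ * ‖∑ i, v i‖) ^ 2 :=
      pow_le_pow_left₀ (by positivity) (hinner.trans (real_inner_le_norm _ _)) 2
    _ = ‖x‖ ^ 2 * ‖∑ i, v i‖ ^ 2 := by ring
    _ ≤ ‖x‖ ^ 2 * (Fintype.card ι * ε ^ 2) := by gcongr
    _ = Fintype.card ι * (ε ^ 2 * ‖x‖ ^ 2) := by ring

/-- Lemma 3.1, at-least-one voting, upper bound: for n disjoint models with pairwise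
orthogonal gradients g_j, any family of pairwise orthogonal nonzero perturbations of
ℓ2 norm at most ε fooling all n models has size at most
min(d, ⌊ε² (Σ_j ‖g_j‖²) / (Σ_j γ_j)²⌋). -/
theorem stmt_2 (d n k : ℕ) (hd : 0 < d) (hn : 0 < n)
    (g : Fin n → EuclideanSpace ℝ (Fin d))
    (hgorth : ∀ i j, i ≠ j → ⟪g i, g j⟫ = 0)
    (γ : Fin n → ℝ) (hγ : ∀ j, 0 < γ j)
    (ε : ℝ) (hε : 0 < ε)
    (r : Fin k → EuclideanSpace ℝ (Fin d))
    (hr0 : ∀ i, r i ≠ 0)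
    (horth : ∀ i j, i ≠ j → ⟪r i, r j⟫ = 0)
    (hnorm : ∀ i, ‖r i‖ ≤ ε)
    (hip : ∀ i j, γ j ≤ ⟪g j, r i⟫) :
    (k : ℝ) ≤ min (d : ℝ)
      ((⌊ε ^ 2 * (∑ j, ‖g j‖ ^ 2) / (∑ j, γ j) ^ 2⌋ : ℤ) : ℝ) := by
  apply le_min
  · have hli : LinearIndependent ℝ r :=
      linearIndependent_of_ne_zero_of_inner_eq_zero hr0 fun i j hij => horth i j hij
    have hcard := hli.fintype_card_le_finrank
    rw [Fintype.card_fin, finrank_euclideanSpace_fin] at hcard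
    exact_mod_cast hcard
  · have hpos : 0 < ∑ j, γ j :=
      Finset.sum_pos (fun j _ => hγ j) ⟨⟨0, hn⟩, Finset.mem_univ _⟩
    have hfool : ∀ i, ∑ j, γ j ≤ ⟪∑ j, g j, r i⟫ := fun i => by
      rw [sum_inner]
      exact Finset.sum_le_sum fun j _ => hip i j
    have hbound := card_mul_sq_le_of_pairwise_orthogonal r horth hnorm _ hpos.le hfool
    rw [norm_sum_sq_of_pairwise_orthogonal g hgorth, Fintype.card_fin] at hbound
    have hfloor : (k : ℤ) ≤ ⌊ε ^ 2 * (∑ j, ‖g j‖ ^ 2) / (∑ j, γ j) ^ 2⌋ := by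
      rw [Int.le_floor, le_div_iff₀ (by positivity)]
      exact_mod_cast hbound
    exact_mod_cast hfloor
end

section
/- (Lemma 3.1, majority voting, upper bound for a fixed target set.) Let d, n be positive integers, let g_1, …, g_n be vectors in the Euclidean space ℝ^d that are pairwise orthogonal, let γ_1, …, γ_n > 0 and ε > 0 be real numbers, and let K ⊆ {1, …, n} be a subset with |K| = ⌈n/2⌉. If r_1, …, r_k are pairwise orthogonal nonzero vectors in ℝ^d satisfying ‖r_i‖₂ ≤ ε and ⟨g_j, r_i⟩ ≥ γ_j for all 1 ≤ i ≤ k and all j ∈ K, then k ≤ min(d, ⌊ε² · (Σ_{j∈K} ‖g_j‖₂²) / (Σ_{j∈K} γ_j)²⌋). -/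
open scoped RealInnerProductSpace

section InnerProduct

variable {E ι : Type*} [NormedAddCommGroup E] [InnerProductSpace ℝ E]

/-- The Pythagorean identity for a finite sum of pairwise orthogonal vectors. -/
theorem norm_sum_sq_of_pairwise_inner_eq_zero {v : ι → E}
    (hv : ∀ i j, i ≠ j → ⟪v i, v j⟫ = 0) (s : Finset ι) :
    ‖∑ i ∈ s, v i‖ ^ 2 = ∑ i ∈ s, ‖v i‖ ^ 2 := by
  rw [← real_inner_self_eq_norm_sq, sum_inner]
  refine Finset.sum_congr rfl fun i hi => ?_
  rw [inner_sum, Finset.sum_eq_single_of_mem i hi fun j _ hji => hv i j hji.symm,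
    real_inner_self_eq_norm_sq]

/-- Pairwise orthogonal vectors of norm at most `ε` whose inner products with `x` are all at
least `c ≥ 0` number at most `ε² ‖x‖² / c²`. -/
theorem card_mul_sq_le_of_le_inner [Fintype ι] {r : ι → E} {x : E} {c ε : ℝ}
    (horth : ∀ i j, i ≠ j → ⟪r i, r j⟫ = 0) (hnorm : ∀ i, ‖r i‖ ≤ ε) (hc : 0 ≤ c)
    (hip : ∀ i, c ≤ ⟪x, r i⟫) :
    (Fintype.card ι : ℝ) * c ^ 2 ≤ ε ^ 2 * ‖x‖ ^ 2 := by
  rcases (Fintype.card ι).eq_zero_or_pos with h | h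
  · rw [h, Nat.cast_zero, zero_mul]
    positivity
  have hk : (0 : ℝ) < Fintype.card ι := by exact_mod_cast h
  have hsum : (Fintype.card ι : ℝ) * c ≤ ‖x‖ * ‖∑ i, r i‖ := by
    calc (Fintype.card ι : ℝ) * c = ∑ _i : ι, c := by simp
      _ ≤ ∑ i, ⟪x, r i⟫ := Finset.sum_le_sum fun i _ => hip i
      _ = ⟪x, ∑ i, r i⟫ := (inner_sum _ _ _).symm
      _ ≤ ‖x‖ * ‖∑ i, r i‖ := real_inner_le_norm _ _
  have hR : ‖∑ i, r i‖ ^ 2 ≤ Fintype.card ι * ε ^ 2 := by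
    calc ‖∑ i, r i‖ ^ 2 = ∑ i, ‖r i‖ ^ 2 :=
          norm_sum_sq_of_pairwise_inner_eq_zero horth Finset.univ
      _ ≤ ∑ _i : ι, ε ^ 2 :=
          Finset.sum_le_sum fun i _ => pow_le_pow_left₀ (norm_nonneg _) (hnorm i) 2
      _ = Fintype.card ι * ε ^ 2 := by simp
  refine le_of_mul_le_mul_left ?_ hk
  calc (Fintype.card ι : ℝ) * (Fintype.card ι * c ^ 2) = (Fintype.card ι * c) ^ 2 := by ring
    _ ≤ (‖x‖ * ‖∑ i, r i‖) ^ 2 := pow_le_pow_left₀ (by positivity) hsum 2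
    _ = ‖x‖ ^ 2 * ‖∑ i, r i‖ ^ 2 := mul_pow _ _ _
    _ ≤ ‖x‖ ^ 2 * (Fintype.card ι * ε ^ 2) := mul_le_mul_of_nonneg_left hR (by positivity)
    _ = Fintype.card ι * (ε ^ 2 * ‖x‖ ^ 2) := by ring

end InnerProduct

/-- Lemma 3.1, majority voting, upper bound for a fixed target set K of ⌈n/2⌉ models:
any family of pairwise orthogonal nonzero perturbations of ℓ2 norm at most ε fooling
every model in K has size at most min(d, ⌊ε² (Σ_{j∈K} ‖g_j‖²) / (Σ_{j∈K} γ_j)²⌋). -/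
theorem stmt_4 (d n k : ℕ) (hd : 0 < d) (hn : 0 < n)
    (g : Fin n → EuclideanSpace ℝ (Fin d))
    (hgorth : ∀ i j, i ≠ j → ⟪g i, g j⟫ = 0)
    (γ : Fin n → ℝ) (hγ : ∀ j, 0 < γ j)
    (ε : ℝ) (hε : 0 < ε)
    (K : Finset (Fin n)) (hK : K.card = (n + 1) / 2)
    (r : Fin k → EuclideanSpace ℝ (Fin d))
    (hr0 : ∀ i, r i ≠ 0)
    (horth : ∀ i j, i ≠ j → ⟪r i, r j⟫ = 0)
    (hnorm : ∀ i, ‖r i‖ ≤ ε)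
    (hip : ∀ i, ∀ j ∈ K, γ j ≤ ⟪g j, r i⟫) :
    (k : ℝ) ≤ min (d : ℝ)
      ((⌊ε ^ 2 * (∑ j ∈ K, ‖g j‖ ^ 2) / (∑ j ∈ K, γ j) ^ 2⌋ : ℤ) : ℝ) := by
  refine le_min ?_ ?_
  · have hli : LinearIndependent ℝ r :=
      linearIndependent_of_ne_zero_of_inner_eq_zero hr0 fun i j hij => horth i j hij
    have hcard := hli.fintype_card_le_finrank
    simp only [Fintype.card_fin, finrank_euclideanSpace] at hcard
    exact_mod_cast hcard
  · have hKne : K.Nonempty := Finset.card_pos.mp (by omega)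
    have hS : 0 < ∑ j ∈ K, γ j := Finset.sum_pos (fun j _ => hγ j) hKne
    have hbound := card_mul_sq_le_of_le_inner horth hnorm hS.le
      (x := ∑ j ∈ K, g j) fun i => by
        rw [sum_inner]
        exact Finset.sum_le_sum (hip i)
    rw [norm_sum_sq_of_pairwise_inner_eq_zero hgorth, Fintype.card_fin] at hbound
    have hfloor : (k : ℤ) ≤ ⌊ε ^ 2 * (∑ j ∈ K, ‖g j‖ ^ 2) / (∑ j ∈ K, γ j) ^ 2⌋ := by
      rw [Int.le_floor, le_div_iff₀ (by positivity)]
      exact_mod_cast hbound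
    exact_mod_cast hfloor
end

section
/- (Core ℓ∞ upper bound on the number of orthogonal adversarial directions.) Let d be a positive integer, let g be a vector in the Euclidean space ℝ^d, and let ε > 0 and γ > 0 be real numbers. If r_1, …, r_k are pairwise orthogonal nonzero vectors in ℝ^d satisfying ‖r_i‖_∞ ≤ ε and ⟨g, r_i⟩ ≥ γ for every 1 ≤ i ≤ k, then k ≤ min(d, ε² · d · ‖g‖₂² / γ²). -/
open scoped RealInnerProductSpace

/-- A vector whose coordinates are at most `ε` in absolute value has squared Euclidean norm at most
`ε ^ 2` times the dimension. -/
theorem EuclideanSpace.norm_sq_le_of_abs_le {ι : Type*} [Fintype ι] {x : EuclideanSpace ℝ ι}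
    {ε : ℝ} (h : ∀ p, |x p| ≤ ε) : ‖x‖ ^ 2 ≤ ε ^ 2 * Fintype.card ι := by
  rw [EuclideanSpace.real_norm_sq_eq]
  calc ∑ p, x p ^ 2 ≤ ∑ _p : ι, ε ^ 2 :=
        Finset.sum_le_sum fun p _ => sq_le_sq' (abs_le.mp (h p)).1 (abs_le.mp (h p)).2
    _ = ε ^ 2 * Fintype.card ι := by simp [mul_comm]

/-- Normalizing a pairwise orthogonal family of nonzero vectors gives an orthonormal family. -/
theorem orthonormal_normalize_of_pairwise {E ι : Type*} [NormedAddCommGroup E]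
    [InnerProductSpace ℝ E] {v : ι → E} (hv : ∀ i, v i ≠ 0)
    (ho : Pairwise fun i j => ⟪v i, v j⟫ = 0) : Orthonormal ℝ fun i => ‖v i‖⁻¹ • v i := by
  refine ⟨fun i => ?_, fun i j hij => ?_⟩
  · rw [norm_smul, norm_inv, norm_norm, inv_mul_cancel₀ (norm_ne_zero_iff.mpr (hv i))]
  · simp [inner_smul_left, inner_smul_right, ho hij]

/-- Pairwise orthogonal nonzero vectors of squared norm at most `R`, each having inner product at
least `γ > 0` with `g`, number at most `R * ‖g‖ ^ 2 / γ ^ 2`. -/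
theorem card_le_of_pairwise_orthogonal_of_le_inner {E ι : Type*} [NormedAddCommGroup E]
    [InnerProductSpace ℝ E] [Fintype ι] {v : ι → E} {g : E} {R γ : ℝ} (hγ : 0 < γ)
    (hR : 0 < R) (hv : ∀ i, v i ≠ 0) (ho : Pairwise fun i j => ⟪v i, v j⟫ = 0)
    (hn : ∀ i, ‖v i‖ ^ 2 ≤ R) (hg : ∀ i, γ ≤ ⟪g, v i⟫) :
    (Fintype.card ι : ℝ) ≤ R * ‖g‖ ^ 2 / γ ^ 2 := by
  have hterm (i : ι) : γ ^ 2 / R ≤ ‖⟪‖v i‖⁻¹ • v i, g⟫‖ ^ 2 := by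
    have hpos : 0 < ‖v i‖ := norm_pos_iff.mpr (hv i)
    have heq : ‖⟪‖v i‖⁻¹ • v i, g⟫‖ ^ 2 = ⟪g, v i⟫ ^ 2 / ‖v i‖ ^ 2 := by
      rw [real_inner_smul_left, real_inner_comm, Real.norm_eq_abs, sq_abs, mul_pow, inv_pow,
        div_eq_inv_mul]
    rw [heq]
    exact div_le_div₀ (sq_nonneg _) (pow_le_pow_left₀ hγ.le (hg i) 2) (by positivity) (hn i)
  have hsum : Fintype.card ι * (γ ^ 2 / R) ≤ ‖g‖ ^ 2 :=
    calc Fintype.card ι * (γ ^ 2 / R) = ∑ _i : ι, γ ^ 2 / R := by simp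
      _ ≤ ∑ i, ‖⟪‖v i‖⁻¹ • v i, g⟫‖ ^ 2 := Finset.sum_le_sum fun i _ => hterm i
      _ ≤ ‖g‖ ^ 2 := (orthonormal_normalize_of_pairwise hv ho).sum_inner_products_le g
  rw [← mul_div_assoc, div_le_iff₀ hR] at hsum
  rw [le_div_iff₀ (by positivity)]
  linarith

/-- Core ℓ∞ upper bound on the number of orthogonal adversarial directions (mechanism
underlying Lemma 3.2): pairwise orthogonal nonzero perturbations with all coordinates
of absolute value at most ε (i.e. ℓ∞ norm at most ε) whose inner product with g is at
least γ number at most min(d, ε² d ‖g‖₂² / γ²). -/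
theorem stmt_11 (d k : ℕ) (hd : 0 < d)
    (g : EuclideanSpace ℝ (Fin d))
    (ε γ : ℝ) (hε : 0 < ε) (hγ : 0 < γ)
    (r : Fin k → EuclideanSpace ℝ (Fin d))
    (hr0 : ∀ i, r i ≠ 0)
    (horth : ∀ i j, i ≠ j → ⟪r i, r j⟫ = 0)
    (hinfty : ∀ i, ∀ p, |r i p| ≤ ε)
    (hip : ∀ i, γ ≤ ⟪g, r i⟫) :
    (k : ℝ) ≤ min (d : ℝ) (ε ^ 2 * d * ‖g‖ ^ 2 / γ ^ 2) := by
  have ho : Pairwise fun i j => ⟪r i, r j⟫ = 0 := fun i j hij => horth i j hij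
  refine le_min ?_ ?_
  · have hli : LinearIndependent ℝ r := linearIndependent_of_ne_zero_of_inner_eq_zero hr0 ho
    have h := hli.fintype_card_le_finrank
    rw [finrank_euclideanSpace, Fintype.card_fin, Fintype.card_fin] at h
    exact_mod_cast h
  · have hn (i : Fin k) : ‖r i‖ ^ 2 ≤ ε ^ 2 * d := by
      simpa using EuclideanSpace.norm_sq_le_of_abs_le (hinfty i)
    simpa using card_le_of_pairwise_orthogonal_of_le_inner hγ (by positivity) hr0 ho hn hip
end

section
/- (Existence of equal-projection orthonormal families, the construction underlying the tightness of the ℓ2 bounds.) Let d be a positive integer, let u be a unit vector in the Euclidean space ℝ^d, and let k be a natural number with 1 ≤ k ≤ d. Then there exist orthonormal vectors z_1, …, z_k in ℝ^d such that ⟨u, z_i⟩ = 1/√k for every 1 ≤ i ≤ k. -/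
open scoped RealInnerProductSpace

/-- The normalized sum of a finite orthonormal family has equal projections on its members. -/
theorem Orthonormal.inner_normalized_sum {ι F : Type*} [Fintype ι]
    [NormedAddCommGroup F] [InnerProductSpace ℝ F] {e : ι → F} (he : Orthonormal ℝ e) (i : ι) :
    ⟪(1 / Real.sqrt (Fintype.card ι)) • ∑ j, e j, e i⟫ = 1 / Real.sqrt (Fintype.card ι) := by
  classical
  simp [inner_smul_left, sum_inner, orthonormal_iff_ite.mp he]

/-- The normalized sum of a nonempty finite orthonormal family is a unit vector. -/
theorem Orthonormal.norm_normalized_sum {ι F : Type*} [Fintype ι] [Nonempty ι]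
    [NormedAddCommGroup F] [InnerProductSpace ℝ F] {e : ι → F} (he : Orthonormal ℝ e) :
    ‖(1 / Real.sqrt (Fintype.card ι)) • ∑ j, e j‖ = 1 := by
  have hpos : (0 : ℝ) < Fintype.card ι := by exact_mod_cast Fintype.card_pos
  have hsq : Real.sqrt (Fintype.card ι) ^ 2 = Fintype.card ι := Real.sq_sqrt hpos.le
  have hne : Real.sqrt (Fintype.card ι) ≠ 0 := (Real.sqrt_pos.mpr hpos).ne'
  rw [← sq_eq_sq₀ (norm_nonneg _) zero_le_one, ← real_inner_self_eq_norm_sq]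
  nth_rewrite 2 [Finset.smul_sum]
  simp only [inner_sum, inner_smul_right, he.inner_normalized_sum, Finset.sum_const,
    Finset.card_univ, nsmul_eq_mul]
  field_simp
  linarith

/-- Existence of equal-projection orthonormal families (the construction underlying the
tightness of the ℓ2 bounds): for a unit vector u and 1 ≤ k ≤ d there are orthonormal
z_1, …, z_k with ⟨u, z_i⟩ = 1/√k for every i. -/
theorem stmt_12 (d : ℕ) (hd : 0 < d)
    (u : EuclideanSpace ℝ (Fin d)) (hu : ‖u‖ = 1)
    (k : ℕ) (hk1 : 1 ≤ k) (hkd : k ≤ d) :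
    ∃ z : Fin k → EuclideanSpace ℝ (Fin d),
      Orthonormal ℝ z ∧ ∀ i, ⟪u, z i⟫ = 1 / Real.sqrt k := by
  have : Nonempty (Fin k) := ⟨⟨0, hk1⟩⟩
  have he : Orthonormal ℝ (EuclideanSpace.basisFun (Fin d) ℝ ∘ Fin.castLE hkd) :=
    (EuclideanSpace.basisFun (Fin d) ℝ).orthonormal.comp _ (Fin.castLE_injective hkd)
  set e := EuclideanSpace.basisFun (Fin d) ℝ ∘ Fin.castLE hkd
  set w := (1 / Real.sqrt (Fintype.card (Fin k))) • ∑ j, e j with hw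
  have hR := Submodule.reflection_sub (he.norm_normalized_sum.trans hu.symm)
  set R := (Submodule.span ℝ {w - u})ᗮ.reflection
  refine ⟨R ∘ e, he.comp_linearIsometryEquiv R, fun i => ?_⟩
  calc ⟪u, R (e i)⟫ = ⟪R w, R (e i)⟫ := by rw [hR]
    _ = ⟪w, e i⟫ := R.inner_map_map _ _
    _ = 1 / Real.sqrt k := by rw [hw, he.inner_normalized_sum, Fintype.card_fin]
end
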